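/- (Discrete Itô formula.) Let τ_1, τ_2, … be independent copies of τ, fix X_0 ∈ ℝ^n, and set X^N_{m/N} := X_0 + N^{-1/2} Σ_{u=1}^m τ_u. Then for every function f : [0,∞) × ℝ^n → ℝ and every integer m ≥ 1, almost surely f(m/N, X^N_{m/N}) − f(0, X_0) = Σ_{u=1}^m [ Σ_{k=1}^n ∂^N_k f(u/N, ·)(X^N_{(u−1)/N}) · (X^{N,k}_{u/N} − X^{N,k}_{(u−1)/N}) + ( (1/2) Δ^N f(u/N, ·)(X^N_{(u−1)/N}) + ∂^N_t f(u/N, X^N_{(u−1)/N}) ) / N ], where X^{N,k} denotes the k-th coordinate of X^N. -/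

import Mathlib

open MeasureTheory

/-- The `j`-th vector `e_j = (e_{1,j}/e_{0,j}, …, e_{n,j}/e_{0,j}) ∈ ℝ^n`. -/
noncomputable def stepVec {n : ℕ} (E : Matrix (Fin (n + 1)) (Fin (n + 1)) ℝ)
    (j : Fin (n + 1)) : Fin n → ℝ :=
  fun k => E k.succ j / E 0 j

/-- The discrete partial derivative `∂^N_k`. -/
noncomputable def dpartial {n : ℕ} (E : Matrix (Fin (n + 1)) (Fin (n + 1)) ℝ) (N : ℕ)
    (k : Fin n) (f : (Fin n → ℝ) → ℝ) (x : Fin n → ℝ) : ℝ :=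
  Real.sqrt N * ∑ j : Fin (n + 1),
    f (x + (Real.sqrt N)⁻¹ • stepVec E j) * (E 0 j * E k.succ j)

/-- The discrete Laplacian `Δ^N`. -/
noncomputable def dlap {n : ℕ} (E : Matrix (Fin (n + 1)) (Fin (n + 1)) ℝ) (N : ℕ)
    (f : (Fin n → ℝ) → ℝ) (x : Fin n → ℝ) : ℝ :=
  2 * N * ∑ j : Fin (n + 1),
    (f (x + (Real.sqrt N)⁻¹ • stepVec E j) - f x) * (E 0 j) ^ 2

lemma orth_cols {n : ℕ} (E : Matrix (Fin (n + 1)) (Fin (n + 1)) ℝ)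
    (hE : E.transpose * E = 1) (i j : Fin (n + 1)) :
    E 0 i * E 0 j + ∑ k : Fin n, E k.succ i * E k.succ j = if i = j then 1 else 0 := by
  have h := congrFun (congrFun hE i) j
  rw [Matrix.mul_apply, Fin.sum_univ_succ, Matrix.one_apply] at h
  simpa [Matrix.transpose_apply] using h

lemma sum_row_zero {n : ℕ} (E : Matrix (Fin (n + 1)) (Fin (n + 1)) ℝ)
    (hE : E.transpose * E = 1) : ∑ j, (E 0 j) ^ 2 = 1 := by
  have hE2 : E * E.transpose = 1 := mul_eq_one_comm.mp hE
  have h := congrFun (congrFun hE2 0) 0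
  rw [Matrix.mul_apply] at h
  simpa [Matrix.transpose_apply, sq] using h

lemma stepVec_inj {n : ℕ} (E : Matrix (Fin (n + 1)) (Fin (n + 1)) ℝ)
    (hE : E.transpose * E = 1) (hEpos : ∀ j, 0 < E 0 j) :
    Function.Injective (stepVec E) := by
  intro i j hij
  by_contra hne
  have h := orth_cols E hE i j
  rw [if_neg hne] at h
  have h1 : ∀ k : Fin n, 0 ≤ E k.succ i * E k.succ j := by
    intro k
    have hk : E k.succ i / E 0 i = E k.succ j / E 0 j := congrFun hij k
    have hi := hEpos i
    have hj := hEpos j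
    have hk2 : E k.succ i = E k.succ j / E 0 j * E 0 i := by
      rw [← hk]; field_simp
    have : E k.succ i * E k.succ j = E k.succ j ^ 2 * (E 0 i / E 0 j) := by
      rw [hk2]; ring
    rw [this]
    positivity
  have h2 := Finset.sum_nonneg (fun k (_ : k ∈ Finset.univ) => h1 k)
  have h3 := mul_pos (hEpos i) (hEpos j)
  linarith

lemma one_step {n : ℕ} (E : Matrix (Fin (n + 1)) (Fin (n + 1)) ℝ)
    (hE : E.transpose * E = 1) (hEpos : ∀ j, 0 < E 0 j) (N : ℕ) (hN : 1 ≤ N)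
    (g : (Fin n → ℝ) → ℝ) (x : Fin n → ℝ) (i : Fin (n + 1)) :
    (∑ k : Fin n, dpartial E N k g x * ((Real.sqrt N)⁻¹ * stepVec E i k))
      + (1 / 2) * dlap E N g x / N = g (x + (Real.sqrt N)⁻¹ • stepVec E i) - g x := by
  have hN0 : (0 : ℝ) < N := by exact_mod_cast hN
  have hs : Real.sqrt N ≠ 0 := (Real.sqrt_pos.mpr hN0).ne'
  have hi := (hEpos i).ne'
  unfold dpartial dlap
  generalize hG : (fun j => g (x + (Real.sqrt N)⁻¹ • stepVec E j)) = G
  have hG' : ∀ j, g (x + (Real.sqrt N)⁻¹ • stepVec E j) = G j := fun j => by rw [← hG]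
  simp only [hG']
  have h1 : (∑ k : Fin n, (Real.sqrt N * ∑ j, G j * (E 0 j * E k.succ j)) *
      ((Real.sqrt N)⁻¹ * stepVec E i k)) = G i - ∑ j, G j * (E 0 j) ^ 2 := by
    calc _ = ∑ k : Fin n, ∑ j, G j * E 0 j / E 0 i * (E k.succ j * E k.succ i) := by
          refine Finset.sum_congr rfl fun k _ => ?_
          rw [Finset.mul_sum, Finset.sum_mul]
          refine Finset.sum_congr rfl fun j _ => ?_
          unfold stepVec
          field_simp
      _ = ∑ j, G j * E 0 j / E 0 i * ((if j = i then 1 else 0) - E 0 j * E 0 i) := by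
          rw [Finset.sum_comm]
          refine Finset.sum_congr rfl fun j _ => ?_
          rw [← Finset.mul_sum, ← orth_cols E hE j i]
          ring
      _ = ∑ j, ((if j = i then G j * E 0 j / E 0 i else 0) - G j * (E 0 j) ^ 2) := by
          refine Finset.sum_congr rfl fun j _ => ?_
          split_ifs <;> field_simp
          ring
      _ = _ := by
          rw [Finset.sum_sub_distrib, Finset.sum_ite_eq' Finset.univ i]
          simp [hi]
  have h2 : ∑ j, (G j - g x) * (E 0 j) ^ 2 = (∑ j, G j * (E 0 j) ^ 2) - g x := by
    simp only [sub_mul, Finset.sum_sub_distrib, ← Finset.mul_sum, sum_row_zero E hE, mul_one]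
  rw [h1, h2]
  field_simp
  ring

lemma ae_step {n : ℕ} (E : Matrix (Fin (n + 1)) (Fin (n + 1)) ℝ)
    (hE : E.transpose * E = 1) (hEpos : ∀ j, 0 < E 0 j)
    {Ω : Type*} [MeasurableSpace Ω] (μ : Measure Ω) [IsProbabilityMeasure μ]
    (t : Ω → Fin n → ℝ) (ht : Measurable t)
    (hlaw : ∀ j, μ {ω | t ω = stepVec E j} = ENNReal.ofReal ((E 0 j) ^ 2)) :
    ∀ᵐ ω ∂μ, ∃ j, t ω = stepVec E j := by
  have hms : ∀ j, MeasurableSet {ω | t ω = stepVec E j} := fun j =>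
    ht (measurableSet_singleton (stepVec E j))
  have hU : μ (⋃ j, {ω | t ω = stepVec E j}) = 1 := by
    rw [measure_iUnion _ hms, tsum_fintype]
    · simp only [hlaw]
      rw [← ENNReal.ofReal_sum_of_nonneg (fun j _ => sq_nonneg _), sum_row_zero E hE,
        ENNReal.ofReal_one]
    · intro i j hij
      refine Set.disjoint_left.mpr fun ω h1 h2 => hij (stepVec_inj E hE hEpos ?_)
      exact (h1 : t ω = _).symm.trans h2
  have := (mem_ae_iff_prob_eq_one (MeasurableSet.iUnion hms)).mpr hU
  filter_upwards [this] with ω hω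
  simpa using hω

/-- Discrete Itô formula: for the random walk `X^N_{m/N} = X₀ + N^{-1/2} ∑_{u=1}^m τ_u`
built from i.i.d. copies of `τ`, almost surely
`f(m/N, X^N_{m/N}) − f(0, X₀) = ∑_u [ ∑_k ∂^N_k f(u/N, X_{(u−1)/N}) ΔX^k
  + ((1/2) Δ^N f + ∂^N_t f)(u/N, X_{(u−1)/N})/N ]`. -/
theorem discrete_ito_formula {n : ℕ} (hn : 1 ≤ n)
    (E : Matrix (Fin (n + 1)) (Fin (n + 1)) ℝ)
    (hE : E.transpose * E = 1) (hEpos : ∀ j, 0 < E 0 j)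
    {Ω : Type*} [MeasurableSpace Ω] (μ : Measure Ω) [IsProbabilityMeasure μ]
    (τs : ℕ → Ω → Fin n → ℝ) (hτm : ∀ u, Measurable (τs u))
    (hlaw : ∀ u j, μ {ω | τs u ω = stepVec E j} = ENNReal.ofReal ((E 0 j) ^ 2))
    (hind : ProbabilityTheory.iIndepFun τs μ)
    (N : ℕ) (hN : 1 ≤ N) (X₀ : Fin n → ℝ) (X : ℕ → Ω → Fin n → ℝ)
    (hX : ∀ m ω, X m ω = X₀ + (Real.sqrt N)⁻¹ • ∑ u ∈ Finset.range m, τs u ω)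
    (f : ℝ → (Fin n → ℝ) → ℝ) (m : ℕ) (hm : 1 ≤ m) :
    ∀ᵐ ω ∂μ, f ((m : ℝ) / N) (X m ω) - f 0 X₀ =
      ∑ u ∈ Finset.range m,
        ((∑ k : Fin n,
            dpartial E N k (f ((u + 1 : ℕ) / (N : ℝ))) (X u ω) * (X (u + 1) ω k - X u ω k))
          + ((1 / 2) * dlap E N (f ((u + 1 : ℕ) / (N : ℝ))) (X u ω)
              + (N : ℝ) * (f ((u + 1 : ℕ) / (N : ℝ)) (X u ω)
                  - f ((u + 1 : ℕ) / (N : ℝ) - (N : ℝ)⁻¹) (X u ω))) / N) := by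
  have hN0 : (0 : ℝ) < N := by exact_mod_cast hN
  have hall : ∀ᵐ ω ∂μ, ∀ u, ∃ j, τs u ω = stepVec E j :=
    ae_all_iff.mpr fun u => ae_step E hE hEpos μ (τs u) (hτm u) (hlaw u)
  filter_upwards [hall] with ω hω
  have h0 : f ((m : ℝ) / N) (X m ω) - f 0 X₀
      = f ((m : ℝ) / N) (X m ω) - f (((0 : ℕ) : ℝ) / N) (X 0 ω) := by
    rw [hX 0 ω]; simp
  rw [h0, ← Finset.sum_range_sub (fun u : ℕ => f ((u : ℝ) / N) (X u ω))]
  refine Finset.sum_congr rfl fun u _ => ?_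
  obtain ⟨j, hj⟩ := hω u
  have hstep : X (u + 1) ω = X u ω + (Real.sqrt N)⁻¹ • stepVec E j := by
    rw [hX, hX, Finset.sum_range_succ, smul_add, hj, add_assoc]
  have hk : ∀ k, X (u + 1) ω k - X u ω k = (Real.sqrt N)⁻¹ * stepVec E j k := by
    intro k; rw [hstep]; simp
  have ht : ((u + 1 : ℕ) : ℝ) / (N : ℝ) - (N : ℝ)⁻¹ = (u : ℝ) / N := by
    push_cast; field_simp; ring
  have h1 := one_step E hE hEpos N hN (f ((u + 1 : ℕ) / (N : ℝ))) (X u ω) j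
  simp only [hk, ht]
  rw [add_div, ← add_assoc, h1, ← hstep, mul_div_cancel_left₀ _ hN0.ne']
  ring
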